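/- Let 0 < α₁ < α₂, set σ = (α₁+α₂)/(2α₂) and δ = κ₂/(8α₁), and let κ₂ > 0 satisfy κ₂ < 4α₁. Let (a₁,a₂) ∈ ℝ² and κ₁ ≥ 0. Set D = 1 + (α₂ + 2|a₂|)(α₂ − α₁)/α₂, N = 1 + 4|a₂|/α₂, C₃ = 1/(2D^δ), C₄ = 1/(3ND^δ), and define φ₃(x,y) = C₃((Dx²+y²)/|y|^{2σ})^δ, φ₄(x,y) = C₄(−x + N|y|^{2(1−σ)δ}), U₃ = {x < −1/2, |y| > 1}, U₄ = {−1 < x < N, |y| > 1}. Let k : ℝ → ℝ be any C^∞ function with k(t) = 0 for t ≤ 0, k(t) = 1 for t ≥ 1, and k′(t) > 0 for t ∈ (0,1), and set ρ_{3,4}(x,y) = k(2x + 2). Then the function φ_{3,4} on U₃ ∪ U₄, defined as φ₃ where x ≤ −1, as φ₄ where x ≥ −1/2, and as ρ_{3,4}φ₄ + (1−ρ_{3,4})φ₃ in between, is a Lyapunov function for L on U₃ ∪ U₄. -/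

import Mathlib

noncomputable def Lop (a₁ a₂ α₁ α₂ κ₁ κ₂ : ℝ) (Φ : ℝ × ℝ → ℝ) (p : ℝ × ℝ) : ℝ :=
  (a₁ * p.1 - α₁ * p.1 ^ 2 + p.2 ^ 2) * deriv (fun t => Φ (t, p.2)) p.1
    + (a₂ * p.2 - α₂ * p.1 * p.2) * deriv (fun t => Φ (p.1, t)) p.2
    + κ₁ * deriv (deriv (fun t => Φ (t, p.2))) p.1
    + κ₂ * deriv (deriv (fun t => Φ (p.1, t))) p.2

/-- `φ` is a Lyapunov function for the operator `L` (with the given parameters) on `U`: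
(I) `φ` is `C^∞` on `U`; (II) `φ z → ∞` as `|z| → ∞`, `z ∈ U`;
(III) there are `C, D > 0` with `Lφ ≤ -C•φ + D` on `U`. -/
def IsLyapunovOn (a₁ a₂ α₁ α₂ κ₁ κ₂ : ℝ) (φ : ℝ × ℝ → ℝ) (U : Set (ℝ × ℝ)) : Prop :=
  ContDiffOn ℝ (⊤ : ℕ∞) φ U ∧
    (∀ M : ℝ, ∃ R : ℝ, ∀ z ∈ U, R < ‖z‖ → M < φ z) ∧
    (∃ C > (0:ℝ), ∃ D > (0:ℝ), ∀ z ∈ U, Lop a₁ a₂ α₁ α₂ κ₁ κ₂ φ z ≤ -C * φ z + D)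
noncomputable def phi3 (C₃ Dc σ δ : ℝ) (p : ℝ × ℝ) : ℝ :=
  C₃ * ((Dc * p.1 ^ 2 + p.2 ^ 2) / |p.2| ^ (2 * σ)) ^ δ

def U3 : Set (ℝ × ℝ) := {p : ℝ × ℝ | p.1 < -1/2 ∧ 1 < |p.2|}

noncomputable def phi4 (C₄ N σ δ : ℝ) (p : ℝ × ℝ) : ℝ :=
  C₄ * (-p.1 + N * |p.2| ^ (2 * (1 - σ) * δ))

def U4 (N : ℝ) : Set (ℝ × ℝ) := {p : ℝ × ℝ | -1 < p.1 ∧ p.1 < N ∧ 1 < |p.2|}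

/-- The patched function `φ_{3,4}` built from a cutoff `k` via `ρ_{3,4}(x,y) = k(2x+2)`. -/
noncomputable def phi34 (k : ℝ → ℝ) (C₃ C₄ Dc N σ δ : ℝ) (p : ℝ × ℝ) : ℝ :=
  if p.1 ≤ -1 then phi3 C₃ Dc σ δ p
  else if -1/2 ≤ p.1 then phi4 C₄ N σ δ p
  else k (2 * p.1 + 2) * phi4 C₄ N σ δ p + (1 - k (2 * p.1 + 2)) * phi3 C₃ Dc σ δ p


theorem aux_T (a₁ a₂ α₁ α₂ κ₁ κ₂ σ Dc : ℝ) (hα₁ : 0 < α₁) (hα : α₁ < α₂)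
    (hσ : σ = (α₁ + α₂) / (2 * α₂)) (hκ₂ : 0 < κ₂)
    (hDc : Dc = 1 + (α₂ + 2 * |a₂|) * (α₂ - α₁) / α₂) :
    ∃ c > (0:ℝ), ∃ K ≥ (0:ℝ), ∀ x w : ℝ, x ≤ -1/2 → 1 ≤ w →
      (a₁ * x - α₁ * x ^ 2 + w) * (2 * Dc * x) + (a₂ - α₂ * x) * (2 * w - 2 * σ * (Dc * x ^ 2 + w))
        + κ₁ * (2 * Dc) + κ₂ * (2 - 8 * σ + (4 * σ ^ 2 + 2 * σ) * ((Dc * x ^ 2 + w) / w))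
        ≤ - c * (-x) * (Dc * x ^ 2 + w) + K := by
  have hα₂ : 0 < α₂ := hα₁.trans hα
  obtain ⟨m, hm⟩ : ∃ m, m = (α₂ - α₁) / α₂ := ⟨_, rfl⟩
  have hm0 : 0 < m := by rw [hm]; exact div_pos (by linarith) hα₂
  have hβ : α₁ = α₂ - α₂ * m := by rw [hm]; field_simp; ring
  have hσ2 : σ = 1 - m / 2 := by rw [hσ, hm]; field_simp; ring
  have hD2 : Dc = 1 + α₂ * m + 2 * |a₂| * m := by rw [hDc, hm]; field_simp; ring
  have hb : 0 < α₂ * m := mul_pos hα₂ hm0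
  have hD1 : 1 ≤ Dc := by rw [hD2]; have := mul_nonneg (abs_nonneg a₂) hm0.le; nlinarith
  have hσ0 : 0 < σ := by rw [hσ]; exact div_pos (by linarith) (by linarith)
  set b := α₂ * m with hbdef
  obtain ⟨g, hg⟩ : ∃ g, g = κ₂ * (4 * σ ^ 2 + 2 * σ) := ⟨_, rfl⟩
  have hg0 : 0 < g := by rw [hg]; positivity
  obtain ⟨c2, hc2⟩ : ∃ c2, c2 = |2 * Dc * (a₁ - σ * a₂)| + g * Dc := ⟨_, rfl⟩
  have hc20 : 0 ≤ c2 := by rw [hc2]; positivity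
  obtain ⟨e, he⟩ : ∃ e, e = Dc * b / 2 := ⟨_, rfl⟩
  have he0 : 0 < e := by rw [he]; positivity
  obtain ⟨K1, hK1⟩ : ∃ K1, K1 = c2 * (c2 / e) ^ 2 := ⟨_, rfl⟩
  have hK10 : 0 ≤ K1 := by rw [hK1]; positivity
  refine ⟨min (b/2) 2, by positivity, K1 + |κ₁ * (2 * Dc) + κ₂ * (2 - 8 * σ) + g|, by positivity, ?_⟩
  intro x w hx hw
  obtain ⟨l, rfl⟩ : ∃ l, x = -l := ⟨-x, by ring⟩
  have hl : 1/2 ≤ l := by linarith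
  have hPw : (Dc * (-l) ^ 2 + w) / w ≤ Dc * l ^ 2 + 1 := by
    rw [div_le_iff₀ (by linarith)]
    nlinarith [mul_nonneg (mul_nonneg (by linarith : 0 ≤ Dc) (sq_nonneg l)) (by linarith : 0 ≤ w - 1)]
  have h1 : κ₂ * (2 - 8 * σ + (4 * σ ^ 2 + 2 * σ) * ((Dc * (-l) ^ 2 + w) / w))
      ≤ κ₂ * (2 - 8 * σ) + g * (Dc * l ^ 2 + 1) := by
    rw [mul_add, ← mul_assoc κ₂ (4 * σ ^ 2 + 2 * σ), ← hg]
    have := mul_le_mul_of_nonneg_left hPw hg0.le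
    linarith
  have h2 : c2 * l ^ 2 ≤ e * l ^ 3 + K1 := by
    rcases le_total c2 (e * l) with h | h
    · nlinarith [mul_le_mul_of_nonneg_right h (sq_nonneg l)]
    · have : l ≤ c2 / e := by rw [le_div_iff₀ he0]; linarith
      have : l ^ 2 ≤ (c2 / e) ^ 2 := by gcongr
      have := mul_le_mul_of_nonneg_left this hc20
      have : 0 ≤ e * l ^ 3 := by positivity
      linarith
  have h3 : min (b/2) 2 * l * (Dc * l ^ 2 + w) ≤ e * l ^ 3 + 2 * l * w := by
    have p1 : min (b/2) 2 * (l * (Dc * l ^ 2)) ≤ b/2 * (l * (Dc * l ^ 2)) :=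
      mul_le_mul_of_nonneg_right (min_le_left _ _) (by positivity)
    have p2 : min (b/2) 2 * (l * w) ≤ 2 * (l * w) :=
      mul_le_mul_of_nonneg_right (min_le_right _ _) (by positivity)
    rw [he]; linarith
  have h4 : 2 * Dc * (a₁ - σ * a₂) * l ^ 2 ≤ |2 * Dc * (a₁ - σ * a₂)| * l ^ 2 :=
    mul_le_mul_of_nonneg_right (le_abs_self _) (by positivity)
  have h5 : a₂ * (m * w) ≤ 2 * |a₂| * m * l * w := by
    have q1 : a₂ * (m * w) ≤ |a₂| * (m * w) := mul_le_mul_of_nonneg_right (le_abs_self _) (by positivity)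
    have q2 : 0 ≤ (|a₂| * (m * w)) * (2 * l - 1) := mul_nonneg (by positivity) (by linarith)
    linarith
  have h6 := le_abs_self (κ₁ * (2 * Dc) + κ₂ * (2 - 8 * σ) + g)
  have h7 : 0 ≤ 2 * |a₂| * m * l * w := by positivity
  have h8 : 0 ≤ b * l * w := by positivity
  have key : (a₁ * -l - α₁ * (-l) ^ 2 + w) * (2 * Dc * -l) + (a₂ - α₂ * -l) * (2 * w - 2 * σ * (Dc * (-l) ^ 2 + w))
      = - 2 * e * l ^ 3 - (2 * Dc - b) * l * w - 2 * Dc * (a₁ - σ * a₂) * l ^ 2 + a₂ * (m * w) + 4 * Dc * (a₁ - σ * a₂) * l^2 := by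
    rw [he, hβ, hσ2, hbdef]; ring
  rw [key]
  have key2 : (2 * Dc - b) * l * w = 2 * l * w + b * l * w + 2 * (2 * |a₂| * m * l * w) := by
    rw [hD2]; ring
  rw [key2, neg_neg, neg_sq]
  rw [hc2] at h2
  rw [neg_sq] at h1
  linarith

theorem aux_L3 (a₁ a₂ α₁ α₂ κ₁ κ₂ σ δ Dc c K C₃ x y f : ℝ) (hD : 1 ≤ Dc)
    (hκ₂ : 0 < κ₂) (hκ₁ : 0 ≤ κ₁) (hδ0 : 0 < δ) (hδ1 : δ < 1) (hc : 0 < c) (hK : 0 ≤ K)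
    (hx : x ≤ -1/2) (hy : 1 ≤ y ^ 2) (hf : 0 ≤ f) (hfP : f ≤ C₃ * (Dc * x ^ 2 + y ^ 2))
    (hT : (a₁ * x - α₁ * x ^ 2 + y^2) * (2 * Dc * x) + (a₂ - α₂ * x) * (2 * y^2 - 2 * σ * (Dc * x ^ 2 + y^2))
        + κ₁ * (2 * Dc) + κ₂ * (2 - 8 * σ + (4 * σ ^ 2 + 2 * σ) * ((Dc * x ^ 2 + y^2) / y^2))
        ≤ - c * (-x) * (Dc * x ^ 2 + y^2) + K) :
    (a₁ * x - α₁ * x ^ 2 + y ^ 2) * (f * (2 * δ * Dc * x / (Dc * x ^ 2 + y ^ 2)))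
    + (a₂ * y - α₂ * x * y) * (f * (2 * δ * y / (Dc * x ^ 2 + y ^ 2) - 2 * (σ * δ) / y))
    + κ₁ * (f * ((2 * δ * Dc * x / (Dc * x ^ 2 + y ^ 2)) ^ 2 + 2 * δ * Dc / (Dc * x ^ 2 + y ^ 2)
        - 4 * δ * Dc ^ 2 * x ^ 2 / (Dc * x ^ 2 + y ^ 2) ^ 2))
    + κ₂ * (f * ((2 * δ * y / (Dc * x ^ 2 + y ^ 2) - 2 * (σ * δ) / y) ^ 2 + 2 * δ / (Dc * x ^ 2 + y ^ 2)
        - 4 * δ * y ^ 2 / (Dc * x ^ 2 + y ^ 2) ^ 2 + 2 * (σ * δ) / y ^ 2))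
    ≤ - (c * δ / 2) * f + K * δ * C₃ := by
  have hy0 : y ≠ 0 := by rintro rfl; norm_num at hy
  obtain ⟨P, hP⟩ : ∃ P, P = Dc * x ^ 2 + y ^ 2 := ⟨_, rfl⟩
  have hP0 : 0 < P := by rw [hP]; positivity
  rw [← hP] at hfP hT ⊢
  have h1 := mul_le_mul_of_nonneg_left hT (show 0 ≤ f * δ / P by positivity)
  have h2 : 0 ≤ κ₁ * (f * (δ * (1 - δ)) * (2 * Dc * x / P) ^ 2) := by
    have : 0 ≤ 1 - δ := by linarith
    positivity
  have h3 : 0 ≤ κ₂ * (f * (δ * (1 - δ)) * (2 * y / P - 2 * σ / y) ^ 2) := by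
    have : 0 ≤ 1 - δ := by linarith
    positivity
  have h4 : f * δ / P * (- c * (-x) * P + K) = - (c * δ) * (-x) * f + K * δ * (f / P) := by
    field_simp
  have h5 : f / P ≤ C₃ := by rw [div_le_iff₀ hP0]; exact hfP
  have h6 := mul_le_mul_of_nonneg_left h5 (show 0 ≤ K * δ by positivity)
  have h7 : 0 ≤ (c * δ * f) * (-x - 1/2) := mul_nonneg (by positivity) (by linarith)
  have e1 : (a₁ * x - α₁ * x ^ 2 + y ^ 2) * (f * (2 * δ * Dc * x / P))
    = f * δ / P * ((a₁ * x - α₁ * x ^ 2 + y^2) * (2 * Dc * x)) := by field_simp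
  have e2 : (a₂ * y - α₂ * x * y) * (f * (2 * δ * y / P - 2 * (σ * δ) / y))
    = f * δ / P * ((a₂ - α₂ * x) * (2 * y^2 - 2 * σ * P)) := by field_simp
  have e3 : κ₁ * (f * ((2 * δ * Dc * x / P) ^ 2 + 2 * δ * Dc / P - 4 * δ * Dc ^ 2 * x ^ 2 / P ^ 2))
    = f * δ / P * (κ₁ * (2 * Dc)) - κ₁ * (f * (δ * (1 - δ)) * (2 * Dc * x / P) ^ 2) := by field_simp; ring
  have e4 : κ₂ * (f * ((2 * δ * y / P - 2 * (σ * δ) / y) ^ 2 + 2 * δ / P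
        - 4 * δ * y ^ 2 / P ^ 2 + 2 * (σ * δ) / y ^ 2))
    = f * δ / P * (κ₂ * (2 - 8 * σ + (4 * σ ^ 2 + 2 * σ) * (P / y^2)))
      - κ₂ * (f * (δ * (1 - δ)) * (2 * y / P - 2 * σ / y) ^ 2) := by field_simp; ring
  rw [e1, e2, e3, e4]
  rw [h4] at h1
  linarith

theorem aux_sq (S e v : ℝ) (he : 0 < e) : S * v ≤ e * v ^ 2 + S ^ 2 / (4 * e) := by
  have : e * v ^ 2 + S ^ 2 / (4 * e) - S * v = (2 * e * v - S) ^ 2 / (4 * e) := by field_simp; ring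
  have h2 : 0 ≤ (2 * e * v - S) ^ 2 / (4 * e) := by positivity
  linarith

theorem aux_L4 (a₁ a₂ α₁ α₂ κ₂ C₄ N q : ℝ) (hα₁ : 0 < α₁) (hα₂ : 0 < α₂) (hκ₂ : 0 < κ₂)
    (hC : 0 < C₄) (hN : 1 ≤ N) (hq : 0 < q) (hq1 : 2 * q ≤ 1) :
    ∃ K : ℝ, ∀ x y v : ℝ, -1 ≤ x → x ≤ N → 1 ≤ y ^ 2 → 1 ≤ v → v ^ 2 ≤ y ^ 2 →
      (a₁ * x - α₁ * x ^ 2 + y ^ 2) * (-C₄) + (a₂ * y - α₂ * x * y) * (C₄ * (N * (v * (2 * q / y))))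
      + κ₂ * (C₄ * (N * (v * ((2 * q / y) ^ 2 - 2 * q / y ^ 2)))) ≤ - (C₄ / 2) * y ^ 2 + K := by
  obtain ⟨S, hS⟩ : ∃ S, S = C₄ * N * (2 * q) * (|a₂| + α₂ * N) := ⟨_, rfl⟩
  refine ⟨C₄ * (|a₁| * N + α₁ * N ^ 2) + S ^ 2 / (4 * (C₄ / 2)), ?_⟩
  intro x y v hx hxN hy hv hvy
  have hy0 : y ≠ 0 := by rintro rfl; norm_num at hy
  have hax : |x| ≤ N := abs_le.2 ⟨by linarith, hxN⟩
  have h1 : -(a₁ * x) ≤ |a₁| * N := by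
    calc -(a₁ * x) ≤ |a₁ * x| := neg_le_abs _
      _ = |a₁| * |x| := abs_mul _ _
      _ ≤ _ := by gcongr
  have h2 : α₁ * x ^ 2 ≤ α₁ * N ^ 2 := by
    have : x ^ 2 ≤ N ^ 2 := by rw [← sq_abs x]; gcongr
    gcongr
  have h3 : a₂ - α₂ * x ≤ |a₂| + α₂ * N := by
    have := le_abs_self a₂
    have : α₂ * (-x) ≤ α₂ * N := by gcongr; linarith
    linarith
  have h4 : (a₂ * y - α₂ * x * y) * (C₄ * (N * (v * (2 * q / y)))) = (C₄ * N * (2 * q) * v) * (a₂ - α₂ * x) := by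
    field_simp
  have h5 : (C₄ * N * (2 * q) * v) * (a₂ - α₂ * x) ≤ S * v := by
    have := mul_le_mul_of_nonneg_left h3 (show 0 ≤ C₄ * N * (2 * q) * v by positivity)
    rw [hS]; linarith
  have h6 : κ₂ * (C₄ * (N * (v * ((2 * q / y) ^ 2 - 2 * q / y ^ 2)))) ≤ 0 := by
    have : (2 * q / y) ^ 2 - 2 * q / y ^ 2 = - ((2 * q) * (1 - 2 * q) / y ^ 2) := by field_simp; ring
    rw [this]
    have h : 0 ≤ (2 * q) * (1 - 2 * q) / y ^ 2 := by
      have : 0 ≤ 1 - 2 * q := by linarith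
      positivity
    have : 0 ≤ κ₂ * (C₄ * (N * (v * ((2 * q) * (1 - 2 * q) / y ^ 2)))) := by positivity
    linarith
  have h7 := aux_sq S (C₄ / 2) v (by positivity)
  have h8 : C₄ / 2 * v ^ 2 ≤ C₄ / 2 * y ^ 2 := by gcongr
  have h9 := mul_le_mul_of_nonneg_left (add_le_add h1 h2) hC.le
  rw [h4]
  linarith

set_option maxHeartbeats 1000000 in
theorem aux_mid (κ₁ c3 K3 e K4 KA KG Cf Cg C₄ b W0 B1 B2 ρ0 : ℝ) (hκ₁ : 0 ≤ κ₁) (hc3 : 0 < c3)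
    (he : 0 < e) (hKA : 0 ≤ KA) (hKG : 0 ≤ KG) (hCf : 0 ≤ Cf) (hCg : 0 ≤ Cg)
    (hW1 : 1 ≤ W0) (hWA : KA ≤ W0) (hB1 : 0 ≤ B1) (hB2 : 0 ≤ B2) (hρ0 : 0 < ρ0) :
    ∃ K : ℝ, ∀ v w f g L3 L4 A G k k1 k2 : ℝ, 1 ≤ v → v ^ 2 ≤ w → 0 ≤ f → 0 ≤ g →
      f ≤ Cf * v → g ≤ Cg * v → L3 ≤ - c3 * f + K3 → L4 ≤ - e * w + K4 → |A - w| ≤ KA →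
      g - f ≤ C₄ - b * v → |G| ≤ KG → (W0 ≤ w → C₄ ≤ b * v) →
      0 ≤ k → k ≤ 1 → 0 ≤ k1 → k1 ≤ B1 → |k2| ≤ B2 →
      ((k ≤ 1/2 ∧ κ₁ * |k2| ≤ c3/4) ∨ ρ0 ≤ k) →
      k * L4 + (1 - k) * L3 + A * (k1 * (g - f)) + κ₁ * (k2 * (g - f) + 2 * k1 * G)
        ≤ - (c3 / 4) * (k * g + (1 - k) * f) + K := by
  obtain ⟨M, hM⟩ : ∃ M, M = (Cf + Cg) * W0 := ⟨_, rfl⟩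
  have hM0 : 0 ≤ M := by rw [hM]; positivity
  obtain ⟨S, hS⟩ : ∃ S, S = (c3 / 4 + κ₁ * B2) * Cf := ⟨_, rfl⟩
  refine ⟨|K3| + |K4| + 2 * κ₁ * B1 * KG + (W0 + KA) * (B1 * M) + κ₁ * (B2 * M) + c3 / 4 * M + S ^ 2 / (4 * (ρ0 * e)), ?_⟩
  intro v w f g L3 L4 A G k k1 k2 hv hvw hf hg hfv hgv hL3 hL4 hA hgf hG hW hk0 hk1 hk10 hk1B hk2 hcase
  have hvw' : v ≤ w := by
    have : v ≤ v ^ 2 := le_self_pow₀ hv (by norm_num)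
    linarith
  have hw0 : 0 ≤ w := by linarith
  have n1 : 0 ≤ (W0 + KA) * (B1 * M) := by positivity
  have n2 : 0 ≤ κ₁ * (B2 * M) := by positivity
  have n3 : 0 ≤ c3 / 4 * M := by positivity
  have n4 : 0 ≤ S ^ 2 / (4 * (ρ0 * e)) := by positivity
  have t3 : (1 - k) * L3 ≤ - c3 * ((1 - k) * f) + |K3| := by
    have h := mul_le_mul_of_nonneg_left hL3 (by linarith : 0 ≤ 1 - k)
    have h2 : (1 - k) * K3 ≤ |K3| := by
      have := mul_le_mul_of_nonneg_left (le_abs_self K3) (by linarith : 0 ≤ 1 - k)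
      have := mul_nonneg hk0 (abs_nonneg K3)
      linarith
    linarith
  have t4 : k * L4 ≤ - e * (k * w) + |K4| := by
    have h := mul_le_mul_of_nonneg_left hL4 hk0
    have h2 : k * K4 ≤ |K4| := by
      have := mul_le_mul_of_nonneg_left (le_abs_self K4) hk0
      have := mul_nonneg (by linarith : 0 ≤ 1 - k) (abs_nonneg K4)
      linarith
    linarith
  have tG : κ₁ * (2 * k1 * G) ≤ 2 * κ₁ * B1 * KG := by
    have h1 : k1 * G ≤ B1 * KG := by
      calc k1 * G ≤ k1 * KG := by gcongr; exact (le_abs_self _).trans hG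
        _ ≤ _ := by gcongr
    have := mul_le_mul_of_nonneg_left h1 hκ₁
    linarith
  rcases le_total W0 w with h | h
  · have hgf0 : g - f ≤ 0 := by linarith [hW h]
    have hA0 : 0 ≤ A := by have := (abs_le.1 hA).1; linarith
    have tA : A * (k1 * (g - f)) ≤ 0 :=
      mul_nonpos_of_nonneg_of_nonpos hA0 (mul_nonpos_of_nonneg_of_nonpos hk10 hgf0)
    have tk : k2 * (g - f) ≤ |k2| * f := by
      have h1 : (-k2) * (f - g) ≤ |k2| * (f - g) :=
        mul_le_mul_of_nonneg_right (neg_le_abs k2) (by linarith)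
      have h2 : |k2| * (f - g) ≤ |k2| * f := by
        apply mul_le_mul_of_nonneg_left _ (abs_nonneg _); linarith
      linarith
    have tk' := mul_le_mul_of_nonneg_left tk hκ₁
    have tφ : k * g + (1 - k) * f ≤ f := by
      have := mul_nonpos_of_nonneg_of_nonpos hk0 hgf0
      linarith
    have tφ' := mul_le_mul_of_nonneg_left tφ (by positivity : 0 ≤ c3 / 4)
    rcases hcase with ⟨hk12, hkk⟩ | hkρ
    · have h1 := mul_le_mul_of_nonneg_right hkk hf
      have h2 : 0 ≤ e * (k * w) := by positivity
      have h3 : 0 ≤ c3 * f * (1/2 - k) := mul_nonneg (by positivity) (by linarith)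
      linarith
    · have h1 : ρ0 * e * v ^ 2 ≤ e * (k * w) := by
        calc ρ0 * e * v ^ 2 ≤ k * e * w := by gcongr
          _ = _ := by ring
      have h2 := aux_sq S (ρ0 * e) v (by positivity)
      have h3 : (c3 / 4 + κ₁ * |k2|) * f ≤ S * v := by
        rw [hS, mul_assoc]; gcongr
      have h4 : 0 ≤ c3 * ((1 - k) * f) := mul_nonneg hc3.le (mul_nonneg (by linarith) hf)
      linarith
  · have hvW : v ≤ W0 := hvw'.trans h
    have hfM : f ≤ M := by
      have : Cf * v ≤ Cf * W0 := by gcongr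
      have : 0 ≤ Cg * W0 := by positivity
      rw [hM]; linarith
    have hgM : g ≤ M := by
      have : Cg * v ≤ Cg * W0 := by gcongr
      have : 0 ≤ Cf * W0 := by positivity
      rw [hM]; linarith
    have hgfM : |g - f| ≤ M := abs_le.2 ⟨by linarith, by linarith⟩
    have hAM : |A| ≤ W0 + KA := by
      have := abs_le.1 hA
      exact abs_le.2 ⟨by linarith, by linarith⟩
    have tA : A * (k1 * (g - f)) ≤ (W0 + KA) * (B1 * M) := by
      calc A * (k1 * (g - f)) ≤ |A * (k1 * (g - f))| := le_abs_self _
        _ = |A| * (k1 * |g - f|) := by rw [abs_mul, abs_mul, abs_of_nonneg hk10]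
        _ ≤ _ := by gcongr
    have tk : κ₁ * (k2 * (g - f)) ≤ κ₁ * (B2 * M) := by
      apply mul_le_mul_of_nonneg_left _ hκ₁
      calc k2 * (g - f) ≤ |k2 * (g - f)| := le_abs_self _
        _ = |k2| * |g - f| := abs_mul _ _
        _ ≤ _ := by gcongr
    have tφ : k * g + (1 - k) * f ≤ M := by
      have p1 := mul_le_mul_of_nonneg_left hgM hk0
      have p2 := mul_le_mul_of_nonneg_left hfM (by linarith : 0 ≤ 1 - k)
      linarith
    have tφ' := mul_le_mul_of_nonneg_left tφ (by positivity : 0 ≤ c3 / 4)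
    have h2 : 0 ≤ e * (k * w) := by positivity
    have h4 : 0 ≤ c3 * ((1 - k) * f) := mul_nonneg hc3.le (mul_nonneg (by linarith) hf)
    linarith

theorem aux_cut (k : ℝ → ℝ) (hk : ContDiff ℝ (⊤ : ℕ∞) k)
    (hk0 : ∀ t ≤ (0:ℝ), k t = 0) (hk1 : ∀ t ≥ (1:ℝ), k t = 1)
    (hk' : ∀ t ∈ Set.Ioo (0:ℝ) 1, 0 < deriv k t) :
    (∀ t, HasDerivAt k (deriv k t) t) ∧ (∀ t, HasDerivAt (deriv k) (deriv (deriv k) t) t) ∧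
    (∀ t, 0 ≤ k t ∧ k t ≤ 1) ∧ (∀ t, 0 ≤ deriv k t) ∧
    (∀ t, t ≤ 0 ∨ 1 ≤ t → deriv k t = 0 ∧ deriv (deriv k) t = 0) ∧
    (∃ B ≥ (0:ℝ), ∀ t ∈ Set.Icc (0:ℝ) 1, |deriv k t| ≤ B) ∧
    (∃ B ≥ (0:ℝ), ∀ t ∈ Set.Icc (0:ℝ) 1, |deriv (deriv k) t| ≤ B) ∧
    (∀ η > 0, ∃ ρ0 > 0, ∀ t ∈ Set.Icc (0:ℝ) 1, (k t ≤ 1/2 ∧ |deriv (deriv k) t| ≤ η) ∨ ρ0 ≤ k t) := by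
  have hd1 : ContDiff ℝ (⊤ : ℕ∞) (deriv k) := by
    exact ((contDiff_infty_iff_deriv (𝕜 := ℝ)).1 hk).2
  have hd2 : ContDiff ℝ (⊤ : ℕ∞) (deriv (deriv k)) := by
    exact ((contDiff_infty_iff_deriv (𝕜 := ℝ)).1 hd1).2
  have D0 : ∀ t, HasDerivAt k (deriv k t) t := fun t => (hk.differentiable (by simp) t).hasDerivAt
  have D1 : ∀ t, HasDerivAt (deriv k) (deriv (deriv k) t) t := fun t => (hd1.differentiable (by simp) t).hasDerivAt
  have zl : ∀ t < (0:ℝ), deriv k t = 0 := by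
    intro t ht
    have : k =ᶠ[nhds t] fun _ => 0 := by
      filter_upwards [Iio_mem_nhds ht] with s hs using hk0 s (le_of_lt hs)
    rw [this.deriv_eq]; simp
  have zr : ∀ t > (1:ℝ), deriv k t = 0 := by
    intro t ht
    have : k =ᶠ[nhds t] fun _ => 1 := by
      filter_upwards [Ioi_mem_nhds ht] with s hs using hk1 s (le_of_lt hs)
    rw [this.deriv_eq]; simp
  have zl2 : ∀ t < (0:ℝ), deriv (deriv k) t = 0 := by
    intro t ht
    have : deriv k =ᶠ[nhds t] fun _ => 0 := by
      filter_upwards [Iio_mem_nhds ht] with s hs using zl s hs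
    rw [this.deriv_eq]; simp
  have zr2 : ∀ t > (1:ℝ), deriv (deriv k) t = 0 := by
    intro t ht
    have : deriv k =ᶠ[nhds t] fun _ => 0 := by
      filter_upwards [Ioi_mem_nhds ht] with s hs using zr s hs
    rw [this.deriv_eq]; simp
  have ext : ∀ g : ℝ → ℝ, Continuous g → (∀ t < (0:ℝ), g t = 0) → (∀ t > (1:ℝ), g t = 0) →
      ∀ t, t ≤ 0 ∨ 1 ≤ t → g t = 0 := by
    intro g hg h0 h1 t ht
    have hc : IsClosed {t | g t = 0} := isClosed_eq hg continuous_const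
    rcases ht with ht | ht
    · have : closure (Set.Iio (0:ℝ)) ⊆ {t | g t = 0} := closure_minimal (fun s hs => h0 s hs) hc
      rw [closure_Iio] at this
      exact this ht
    · have : closure (Set.Ioi (1:ℝ)) ⊆ {t | g t = 0} := closure_minimal (fun s hs => h1 s hs) hc
      rw [closure_Ioi] at this
      exact this ht
  have Z : ∀ t, t ≤ 0 ∨ 1 ≤ t → deriv k t = 0 ∧ deriv (deriv k) t = 0 := fun t ht =>
    ⟨ext _ hd1.continuous zl zr t ht, ext _ hd2.continuous zl2 zr2 t ht⟩
  have P1 : ∀ t, 0 ≤ deriv k t := by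
    intro t
    by_cases h : t ∈ Set.Ioo (0:ℝ) 1
    · exact (hk' t h).le
    · have : t ≤ 0 ∨ 1 ≤ t := by
        by_contra hh; push Not at hh; exact h ⟨hh.1, hh.2⟩
      rw [(Z t this).1]
  have mono : Monotone k := monotone_of_deriv_nonneg (hk.differentiable (by simp)) P1
  have sm : StrictMonoOn k (Set.Icc 0 1) := by
    apply strictMonoOn_of_deriv_pos (convex_Icc 0 1) hk.continuous.continuousOn
    rw [interior_Icc]; exact hk'
  have bd : ∀ g : ℝ → ℝ, Continuous g → ∃ B ≥ (0:ℝ), ∀ t ∈ Set.Icc (0:ℝ) 1, |g t| ≤ B := by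
    intro g hg
    obtain ⟨B, hB⟩ := (isCompact_Icc (a := (0:ℝ)) (b := 1)).exists_bound_of_continuousOn hg.continuousOn
    exact ⟨B, (norm_nonneg _).trans (hB 0 (by simp)), fun t ht => hB t ht⟩
  refine ⟨D0, D1, ?_, P1, Z, bd _ hd1.continuous, bd _ hd2.continuous, ?_⟩
  · intro t
    constructor
    · have := mono (min_le_left t 0)
      rwa [hk0 _ (min_le_right t 0)] at this
    · have := mono (le_max_left t 1)
      rwa [hk1 _ (le_max_right t 1)] at this
  · intro η hη
    have e1 : ∀ᶠ t in nhds (0:ℝ), k t < 1/2 :=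
      hk.continuous.continuousAt.eventually_lt_const (by rw [hk0 0 le_rfl]; norm_num)
    have e2 : ∀ᶠ t in nhds (0:ℝ), |deriv (deriv k) t| < η :=
      hd2.continuous.abs.continuousAt.eventually_lt_const (by simp only [(Z 0 (Or.inl le_rfl)).2, abs_zero]; exact hη)
    obtain ⟨ε, hε, h⟩ := Metric.eventually_nhds_iff.1 (e1.and e2)
    refine ⟨k (min (ε/2) 1), ?_, ?_⟩
    · have := sm (a := 0) (b := min (ε/2) 1) (by simp) ⟨by positivity, min_le_right _ _⟩ (by positivity)
      rwa [hk0 0 le_rfl] at this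
    · intro t ht
      rcases lt_or_ge t ε with h1 | h1
      · left
        have := h (y := t) (by rw [Real.dist_eq, sub_zero, abs_of_nonneg ht.1]; exact h1)
        exact ⟨this.1.le, this.2.le⟩
      · right
        exact mono ((min_le_left _ _).trans (by linarith))

theorem aux_dpow (q t : ℝ) (ht : t ≠ 0) :
    HasDerivAt (fun t : ℝ => (t ^ 2) ^ q) ((t ^ 2) ^ q * (2 * q / t)) t := by
  have h : HasDerivAt (fun t : ℝ => t ^ 2) (2 * t) t := by simpa using hasDerivAt_pow 2 t
  have hp : 0 < t ^ 2 := by positivity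
  have := h.rpow_const (p := q) (Or.inl hp.ne')
  convert this using 1
  rw [Real.rpow_sub hp, Real.rpow_one]
  field_simp

theorem aux_dpow2 (q t : ℝ) (ht : t ≠ 0) :
    HasDerivAt (fun t : ℝ => (t ^ 2) ^ q * (2 * q / t)) ((t ^ 2) ^ q * ((2 * q / t) ^ 2 - 2 * q / t ^ 2)) t := by
  have h := (aux_dpow q t ht).mul ((hasDerivAt_const t (2 * q)).div (hasDerivAt_id t) ht)
  refine h.congr_deriv ?_
  simp only [id, Pi.div_apply]
  field_simp
  ring

theorem aux_dP (δ u w t : ℝ) (d : ℝ) (hP : 0 < u * t ^ 2 + w) (hd : d = 2 * δ * u * t / (u * t ^ 2 + w)) :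
    HasDerivAt (fun t : ℝ => (u * t ^ 2 + w) ^ δ) ((u * t ^ 2 + w) ^ δ * d) t := by
  have h : HasDerivAt (fun t : ℝ => u * t ^ 2 + w) (u * (2 * t)) t := by
    simpa using ((hasDerivAt_pow 2 t).const_mul u).add_const w
  have := h.rpow_const (p := δ) (Or.inl hP.ne')
  convert this using 1
  rw [Real.rpow_sub hP, Real.rpow_one, hd]
  field_simp

theorem aux_dP2 (δ u w t : ℝ) (hP : 0 < u * t ^ 2 + w) :
    HasDerivAt (fun t : ℝ => 2 * δ * u * t / (u * t ^ 2 + w))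
      (2 * δ * u / (u * t ^ 2 + w) - 4 * δ * u ^ 2 * t ^ 2 / (u * t ^ 2 + w) ^ 2) t := by
  have h : HasDerivAt (fun t : ℝ => u * t ^ 2 + w) (u * (2 * t)) t := by
    simpa using ((hasDerivAt_pow 2 t).const_mul u).add_const w
  have h2 := ((hasDerivAt_id t).const_mul (2 * δ * u)).div h hP.ne'
  refine h2.congr_deriv ?_
  simp only [id]
  field_simp
  ring

noncomputable def psi (k : ℝ → ℝ) (C₃ C₄ Dc N q r δ : ℝ) (p : ℝ × ℝ) : ℝ :=
  k (2 * p.1 + 2) * (C₄ * (-p.1 + N * (p.2 ^ 2) ^ q))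
    + (1 - k (2 * p.1 + 2)) * (C₃ * ((Dc * p.1 ^ 2 + p.2 ^ 2) ^ δ * (p.2 ^ 2) ^ (-r)))

theorem aux_abs (y s : ℝ) : |y| ^ (2 * s) = (y ^ 2) ^ s := by
  rw [← sq_abs y, Real.rpow_mul (abs_nonneg y)]
  norm_num

theorem aux_phi3 (C₃ Dc σ δ : ℝ) (hD : 0 ≤ Dc) (p : ℝ × ℝ) :
    phi3 C₃ Dc σ δ p = C₃ * ((Dc * p.1 ^ 2 + p.2 ^ 2) ^ δ * (p.2 ^ 2) ^ (-(σ * δ))) := by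
  unfold phi3
  rw [aux_abs, Real.div_rpow (by positivity) (by positivity), ← Real.rpow_mul (by positivity),
    Real.rpow_neg (by positivity), div_eq_mul_inv]

theorem aux_phi34 (k : ℝ → ℝ) (C₃ C₄ Dc N σ δ : ℝ) (hD : 0 ≤ Dc)
    (hk0 : ∀ t ≤ (0:ℝ), k t = 0) (hk1 : ∀ t ≥ (1:ℝ), k t = 1) :
    phi34 k C₃ C₄ Dc N σ δ = psi k C₃ C₄ Dc N ((1 - σ) * δ) (σ * δ) δ := by
  funext p
  have h4 : phi4 C₄ N σ δ p = C₄ * (-p.1 + N * (p.2 ^ 2) ^ ((1 - σ) * δ)) := by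
    unfold phi4; rw [mul_assoc 2, aux_abs]
  unfold phi34 psi
  rw [← h4, ← aux_phi3 C₃ Dc σ δ hD]
  split_ifs with h1 h2
  · rw [hk0 _ (by linarith)]; ring
  · rw [hk1 _ (by linarith)]; ring
  · rfl

theorem aux_smooth (k : ℝ → ℝ) (C₃ C₄ Dc N q r δ : ℝ) (hD : 0 ≤ Dc) (hk : ContDiff ℝ (⊤ : ℕ∞) k)
    (U : Set (ℝ × ℝ)) (hU : ∀ p ∈ U, p.2 ≠ 0) :
    ContDiffOn ℝ (⊤ : ℕ∞) (psi k C₃ C₄ Dc N q r δ) U := by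
  intro p hp
  apply ContDiffAt.contDiffWithinAt
  have hy := hU p hp
  have hy2 : p.2 ^ 2 ≠ 0 := pow_ne_zero 2 hy
  have hP : Dc * p.1 ^ 2 + p.2 ^ 2 ≠ 0 := by positivity
  have c1 : ContDiffAt ℝ (⊤ : ℕ∞) (fun p : ℝ × ℝ => p.1) p := contDiffAt_fst
  have c2 : ContDiffAt ℝ (⊤ : ℕ∞) (fun p : ℝ × ℝ => p.2) p := contDiffAt_snd
  have ck : ContDiffAt ℝ (⊤ : ℕ∞) (fun p : ℝ × ℝ => k (2 * p.1 + 2)) p :=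
    hk.contDiffAt.comp p ((contDiffAt_const.mul c1).add contDiffAt_const)
  have e1 : ContDiffAt ℝ (⊤ : ℕ∞) (fun p : ℝ × ℝ => (p.2 ^ 2) ^ q) p :=
    (c2.pow 2).rpow_const_of_ne hy2
  have e2 : ContDiffAt ℝ (⊤ : ℕ∞) (fun p : ℝ × ℝ => (p.2 ^ 2) ^ (-r)) p :=
    (c2.pow 2).rpow_const_of_ne hy2
  have e3 : ContDiffAt ℝ (⊤ : ℕ∞) (fun p : ℝ × ℝ => (Dc * p.1 ^ 2 + p.2 ^ 2) ^ δ) p :=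
    ((contDiffAt_const.mul (c1.pow 2)).add (c2.pow 2)).rpow_const_of_ne hP
  exact (ck.mul (contDiffAt_const.mul (c1.neg.add (contDiffAt_const.mul e1)))).add
    ((contDiffAt_const.sub ck).mul (contDiffAt_const.mul (e3.mul e2)))

theorem aux_Lop (a₁ a₂ α₁ α₂ κ₁ κ₂ : ℝ) (Φ : ℝ × ℝ → ℝ) (x y : ℝ) (hy : y ≠ 0)
    (F1 G1 : ℝ → ℝ) (F2 G2 : ℝ)
    (h1 : ∀ t, HasDerivAt (fun t => Φ (t, y)) (F1 t) t) (h2 : HasDerivAt F1 F2 x)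
    (h3 : ∀ t ≠ 0, HasDerivAt (fun t => Φ (x, t)) (G1 t) t) (h4 : HasDerivAt G1 G2 y) :
    Lop a₁ a₂ α₁ α₂ κ₁ κ₂ Φ (x, y) = (a₁ * x - α₁ * x ^ 2 + y ^ 2) * F1 x
      + (a₂ * y - α₂ * x * y) * G1 y + κ₁ * F2 + κ₂ * G2 := by
  unfold Lop
  have e1 : deriv (fun t => Φ (t, y)) = F1 := funext fun t => (h1 t).deriv
  have e2 : deriv (fun t => Φ (x, t)) =ᶠ[nhds y] G1 := by
    filter_upwards [isOpen_ne.mem_nhds hy] with t ht using (h3 t ht).deriv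
  simp only
  rw [e1, h2.deriv, e2.deriv_eq, h4.deriv, (h3 y hy).deriv]

theorem aux_Lpsi (a₁ a₂ α₁ α₂ κ₁ κ₂ : ℝ) (k k1 k2 : ℝ → ℝ) (C₃ C₄ Dc N q r δ : ℝ) (hD : 0 < Dc)
    (hk1 : ∀ t, HasDerivAt k (k1 t) t) (hk2 : ∀ t, HasDerivAt k1 (k2 t) t) (x y : ℝ) (hy : y ≠ 0)
    (v f g K K1 K2 P L3 L4 : ℝ) (hv : v = (y ^ 2) ^ q) (hP : P = Dc * x ^ 2 + y ^ 2)
    (hf : f = C₃ * (P ^ δ * (y ^ 2) ^ (-r)))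
    (hg : g = C₄ * (-x + N * v)) (hK : K = k (2 * x + 2)) (hK1 : K1 = 2 * k1 (2 * x + 2))
    (hK2 : K2 = 4 * k2 (2 * x + 2))
    (hL3 : L3 = (a₁ * x - α₁ * x ^ 2 + y ^ 2) * (f * (2 * δ * Dc * x / P))
    + (a₂ * y - α₂ * x * y) * (f * (2 * δ * y / P - 2 * r / y))
    + κ₁ * (f * ((2 * δ * Dc * x / P) ^ 2 + 2 * δ * Dc / P - 4 * δ * Dc ^ 2 * x ^ 2 / P ^ 2))
    + κ₂ * (f * ((2 * δ * y / P - 2 * r / y) ^ 2 + 2 * δ / P - 4 * δ * y ^ 2 / P ^ 2 + 2 * r / y ^ 2)))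
    (hL4 : L4 = (a₁ * x - α₁ * x ^ 2 + y ^ 2) * (-C₄) + (a₂ * y - α₂ * x * y) * (C₄ * (N * (v * (2 * q / y))))
      + κ₂ * (C₄ * (N * (v * ((2 * q / y) ^ 2 - 2 * q / y ^ 2))))) :
    Lop a₁ a₂ α₁ α₂ κ₁ κ₂ (psi k C₃ C₄ Dc N q r δ) (x, y) =
      K * L4 + (1 - K) * L3 + (a₁ * x - α₁ * x ^ 2 + y ^ 2) * (K1 * (g - f))
       + κ₁ * (K2 * (g - f) + 2 * K1 * (-C₄ - f * (2 * δ * Dc * x / P))) := by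
  have hy2 : 0 < y ^ 2 := by positivity
  have lin : ∀ t : ℝ, HasDerivAt (fun t : ℝ => 2 * t + 2) 2 t := fun t => by
    simpa using ((hasDerivAt_id t).const_mul 2).add_const 2
  have dk : ∀ t, HasDerivAt (fun t => k (2 * t + 2)) (k1 (2 * t + 2) * 2) t := fun t =>
    (hk1 _).comp t (lin t)
  have dk1 : ∀ t, HasDerivAt (fun t => k1 (2 * t + 2) * 2) (k2 (2 * t + 2) * 2 * 2) t := fun t =>
    ((hk2 _).comp t (lin t)).mul_const 2
  have dg : ∀ t, HasDerivAt (fun t => C₄ * (-t + N * (y ^ 2) ^ q)) (-C₄) t := fun t => by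
    simpa using ((hasDerivAt_id t).neg.add_const (N * (y ^ 2) ^ q)).const_mul C₄
  have dF : ∀ t, HasDerivAt (fun t => C₃ * ((Dc * t ^ 2 + y ^ 2) ^ δ * (y ^ 2) ^ (-r)))
      (C₃ * ((Dc * t ^ 2 + y ^ 2) ^ δ * (y ^ 2) ^ (-r)) * (2 * δ * Dc * t / (Dc * t ^ 2 + y ^ 2))) t := fun t => by
    have := ((aux_dP δ Dc (y ^ 2) t _ (by positivity) rfl).mul_const ((y ^ 2) ^ (-r))).const_mul C₃
    refine this.congr_deriv ?_
    ring
  have dfy : ∀ t ≠ 0, HasDerivAt (fun t => C₃ * ((Dc * x ^ 2 + t ^ 2) ^ δ * (t ^ 2) ^ (-r)))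
      (C₃ * ((Dc * x ^ 2 + t ^ 2) ^ δ * (t ^ 2) ^ (-r)) * (2 * δ * t / (Dc * x ^ 2 + t ^ 2) - 2 * r / t)) t := by
    intro t ht
    have h1 : HasDerivAt (fun t : ℝ => (Dc * x ^ 2 + t ^ 2) ^ δ)
        ((Dc * x ^ 2 + t ^ 2) ^ δ * (2 * δ * t / (Dc * x ^ 2 + t ^ 2))) t := by
      have := aux_dP δ 1 (Dc * x ^ 2) t _ (by positivity) rfl
      simp only [one_mul, mul_one, add_comm _ (Dc * x ^ 2)] at this
      exact this
    have := (h1.mul (aux_dpow (-r) t ht)).const_mul C₃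
    refine this.congr_deriv ?_
    ring
  have dfy2 : HasDerivAt (fun t => 2 * δ * t / (Dc * x ^ 2 + t ^ 2) - 2 * r / t)
      (2 * δ / P - 4 * δ * y ^ 2 / P ^ 2 + 2 * r / y ^ 2) y := by
    have h1 := aux_dP2 δ 1 (Dc * x ^ 2) y (by positivity)
    simp only [one_mul, mul_one, one_pow, add_comm _ (Dc * x ^ 2), ← hP] at h1
    have h2 := (hasDerivAt_const y (2 * r)).div (hasDerivAt_id y) hy
    refine (h1.sub h2).congr_deriv ?_
    simp only [id]
    field_simp
    ring
  have dgy : ∀ t ≠ 0, HasDerivAt (fun t => C₄ * (-x + N * (t ^ 2) ^ q)) (C₄ * (N * ((t ^ 2) ^ q * (2 * q / t)))) t :=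
    fun t ht => (((aux_dpow q t ht).const_mul N).const_add (-x)).const_mul C₄
  have dgy2 := ((aux_dpow2 q y hy).const_mul N).const_mul C₄
  have X1 : ∀ t, HasDerivAt (fun t => psi k C₃ C₄ Dc N q r δ (t, y)) _ t := fun t =>
    ((dk t).mul (dg t)).add (((dk t).const_sub 1).mul (dF t))
  have X2 := (((dk1 x).mul (dg x)).add ((dk x).mul (hasDerivAt_const x (-C₄)))).add
    (((dk1 x).neg.mul (dF x)).add (((dk x).const_sub 1).mul ((dF x).mul (aux_dP2 δ Dc (y ^ 2) x (by positivity)))))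
  have Y1 : ∀ t ≠ 0, HasDerivAt (fun t => psi k C₃ C₄ Dc N q r δ (x, t)) _ t := fun t ht =>
    ((dgy t ht).const_mul (k (2 * x + 2))).add ((dfy t ht).const_mul (1 - k (2 * x + 2)))
  have Y2 := (dgy2.const_mul (k (2 * x + 2))).add (((dfy y hy).mul dfy2).const_mul (1 - k (2 * x + 2)))
  have := aux_Lop a₁ a₂ α₁ α₂ κ₁ κ₂ _ x y hy _ _ _ _ X1 X2 Y1 Y2
  rw [this, hL3, hL4, hg]
  simp only [Pi.mul_apply, Pi.neg_apply, ← hP, ← hv, ← hf, ← hK]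
  rw [hK1, hK2]
  ring

theorem aux_flow (C₃ P w m q r δ : ℝ) (hC : 0 ≤ C₃) (hw : 1 ≤ w) (hwm : w ≤ m) (hmP : m ≤ P)
    (hr : 0 < r) (hδ : 0 < δ) (hq : q = δ - r) :
    C₃ * m ^ q ≤ C₃ * (P ^ δ * w ^ (-r)) := by
  apply mul_le_mul_of_nonneg_left _ hC
  have hm : 0 < m := by linarith
  rw [hq, sub_eq_add_neg, Real.rpow_add hm]
  have h1 : m ^ δ ≤ P ^ δ := Real.rpow_le_rpow hm.le hmP hδ.le
  have h2 : m ^ (-r) ≤ w ^ (-r) := Real.rpow_le_rpow_of_nonpos (by linarith) hwm (by linarith)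
  have h0 : 0 ≤ P ^ δ := Real.rpow_nonneg (by linarith) _
  gcongr

theorem aux_fP (C₃ P w r δ : ℝ) (hC : 0 ≤ C₃) (hw : 1 ≤ w) (hP : 1 ≤ P)
    (hr : 0 < r) (hδ1 : δ ≤ 1) : C₃ * (P ^ δ * w ^ (-r)) ≤ C₃ * P := by
  apply mul_le_mul_of_nonneg_left _ hC
  have h1 : P ^ δ ≤ P ^ (1:ℝ) := Real.rpow_le_rpow_of_exponent_le hP hδ1
  rw [Real.rpow_one] at h1
  have h2 : w ^ (-r) ≤ 1 := Real.rpow_le_one_of_one_le_of_nonpos hw (by linarith)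
  calc P ^ δ * w ^ (-r) ≤ P * 1 := by gcongr
    _ = P := mul_one P

theorem aux_fup (C₃ P w E q r δ : ℝ) (hC : 0 ≤ C₃) (hw : 1 ≤ w) (hP0 : 0 ≤ P) (hP : P ≤ E * w) (hE : 1 ≤ E)
    (hδ : 0 < δ) (hδ1 : δ ≤ 1) (hq : q = δ - r) :
    C₃ * (P ^ δ * w ^ (-r)) ≤ C₃ * E * w ^ q := by
  rw [mul_assoc]
  apply mul_le_mul_of_nonneg_left _ hC
  have hw0 : 0 < w := by linarith
  have h1 : P ^ δ ≤ (E * w) ^ δ := Real.rpow_le_rpow hP0 hP hδ.le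
  rw [Real.mul_rpow (by linarith) hw0.le] at h1
  have h2 : E ^ δ ≤ E ^ (1:ℝ) := Real.rpow_le_rpow_of_exponent_le hE hδ1
  rw [Real.rpow_one] at h2
  rw [hq, sub_eq_add_neg, Real.rpow_add hw0, ← mul_assoc]
  have h3 : P ^ δ ≤ E * w ^ δ := h1.trans (by gcongr)
  gcongr

theorem aux_large (q c : ℝ) (hq : 0 < q) : ∃ W : ℝ, ∀ w ≥ W, c < w ^ q := by
  have := (tendsto_rpow_atTop hq).eventually_gt_atTop c
  exact Filter.eventually_atTop.1 this

theorem aux_lyap (a₁ a₂ α₁ α₂ κ₁ κ₂ σ δ Dc N C₃ C₄ d : ℝ)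
    (hα₁ : 0 < α₁) (hα : α₁ < α₂)
    (hσ : σ = (α₁ + α₂) / (2 * α₂)) (hδ0 : 0 < δ) (hδ1 : δ < 1 / 2)
    (hκ₂ : 0 < κ₂) (hκ₁ : 0 ≤ κ₁)
    (hDc : Dc = 1 + (α₂ + 2 * |a₂|) * (α₂ - α₁) / α₂) (hN1 : 1 ≤ N) (hd : 0 < d)
    (hC₃ : C₃ = 1 / (2 * d)) (hC₄ : C₄ = 1 / (3 * N * d))
    (k : ℝ → ℝ) (hk : ContDiff ℝ (⊤ : ℕ∞) k)
    (hk0 : ∀ t ≤ (0:ℝ), k t = 0) (hk1 : ∀ t ≥ (1:ℝ), k t = 1)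
    (hk' : ∀ t ∈ Set.Ioo (0:ℝ) 1, 0 < deriv k t) :
    IsLyapunovOn a₁ a₂ α₁ α₂ κ₁ κ₂ (psi k C₃ C₄ Dc N ((1 - σ) * δ) (σ * δ) δ) (U3 ∪ U4 N) := by
  have hα₂ : 0 < α₂ := hα₁.trans hα
  have hσ0 : 0 < σ := by rw [hσ]; positivity
  have hσ1 : σ < 1 := by rw [hσ, div_lt_one (by positivity)]; linarith
  have hD1 : 1 ≤ Dc := by
    rw [hDc]
    have : 0 ≤ (α₂ + 2 * |a₂|) * (α₂ - α₁) / α₂ := by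
      have : 0 < α₂ - α₁ := by linarith
      positivity
    linarith
  have hC₃0 : 0 < C₃ := by rw [hC₃]; positivity
  have hC₄0 : 0 < C₄ := by rw [hC₄]; positivity
  have hC₄N : C₄ * N = 1 / (3 * d) := by rw [hC₄]; field_simp
  have hCC : C₃ - C₄ * N = 1 / (6 * d) := by rw [hC₄N, hC₃]; field_simp; norm_num
  obtain ⟨b, hb⟩ : ∃ b, b = 1 / (6 * d) := ⟨_, rfl⟩
  have hb0 : 0 < b := by rw [hb]; positivity
  obtain ⟨q, hq⟩ : ∃ q, q = (1 - σ) * δ := ⟨_, rfl⟩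
  obtain ⟨r, hr⟩ : ∃ r, r = σ * δ := ⟨_, rfl⟩
  have hq0 : 0 < q := by rw [hq]; exact mul_pos (by linarith) hδ0
  have hr0 : 0 < r := by rw [hr]; positivity
  have hqr : q = δ - r := by rw [hq, hr]; ring
  have hq1 : 2 * q ≤ 1 := by linarith
  rw [← hq, ← hr]
  have hU : ∀ x y : ℝ, (x, y) ∈ U3 ∪ U4 N → 1 < |y| ∧ x < N ∧ (-1/2 ≤ x → x ≤ N) := by
    rintro x y (⟨h1, h2⟩ | ⟨h1, h2, h3⟩)
    · simp only at h1 h2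
      exact ⟨h2, by linarith, fun h => by linarith⟩
    · exact ⟨h3, h2, fun _ => h2.le⟩
  obtain ⟨D0, D1, hk01, hk1p, hkz, ⟨B1, hB10, hB1⟩, ⟨B2, hB20, hB2⟩, hkρ⟩ := aux_cut k hk hk0 hk1 hk'
  have hw1 : ∀ y : ℝ, 1 < |y| → 1 ≤ y ^ 2 := fun y hy => by
    rw [← sq_abs]; exact one_le_pow₀ hy.le
  refine ⟨?_, ?_, ?_⟩
  · apply aux_smooth k C₃ C₄ Dc N q r δ (by linarith) hk
    rintro ⟨x, y⟩ hp h
    have := (hU x y hp).1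
    simp only at h
    rw [h] at this; norm_num at this
  · intro M0
    obtain ⟨R0, hR0⟩ := aux_large q (M0 / (C₄ * N) + 1) hq0
    refine ⟨max R0 N, ?_⟩
    rintro ⟨x, y⟩ hz hR
    obtain ⟨hy, hxN, -⟩ := hU x y hz
    obtain ⟨n, hn⟩ : ∃ n, n = ‖((x, y) : ℝ × ℝ)‖ := ⟨_, rfl⟩
    rw [← hn] at hR
    have hn' : n = max |x| |y| := by rw [hn, Prod.norm_def]; rfl
    have hnR : R0 < n := lt_of_le_of_lt (le_max_left _ _) hR
    have hnN : N < n := lt_of_le_of_lt (le_max_right _ _) hR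
    have hn1 : n ≤ n ^ 2 := le_self_pow₀ (by linarith) (by norm_num)
    have hbig := hR0 (n ^ 2) (by linarith)
    have hCN : 0 < C₄ * N := by positivity
    have hbig2 : M0 < C₄ * N * ((n ^ 2) ^ q - 1) := by
      have : M0 / (C₄ * N) < (n ^ 2) ^ q - 1 := by linarith
      rw [div_lt_iff₀ hCN] at this
      linarith
    have hyn : y ^ 2 ≤ n ^ 2 := by
      rw [← sq_abs y, hn']; gcongr; exact le_max_right _ _
    have hnP : n ^ 2 ≤ Dc * x ^ 2 + y ^ 2 := by
      have h1 : x ^ 2 ≤ Dc * x ^ 2 := le_mul_of_one_le_left (sq_nonneg x) hD1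
      rcases max_cases |x| |y| with ⟨h, -⟩ | ⟨h, -⟩
      · rw [hn', h, sq_abs]; linarith [sq_nonneg y]
      · rw [hn', h, sq_abs]; linarith [sq_nonneg x]
    have hf := aux_flow C₃ (Dc * x ^ 2 + y ^ 2) (y ^ 2) (n ^ 2) q r δ hC₃0.le (hw1 y hy) hyn hnP hr0 hδ0 hqr
    have hf2 : M0 < C₃ * ((Dc * x ^ 2 + y ^ 2) ^ δ * (y ^ 2) ^ (-r)) := by
      have : C₄ * N * (n ^ 2) ^ q ≤ C₃ * (n ^ 2) ^ q := by
        apply mul_le_mul_of_nonneg_right _ (by positivity)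
        linarith
      linarith
    unfold psi
    simp only
    rcases le_or_gt x (-1) with hx | hx
    · rw [hk0 _ (by linarith)]; linarith
    · have hxn : |x| < n := lt_of_le_of_lt (abs_le.2 ⟨by linarith, hxN.le⟩) hnN
      have hny : n = |y| := by
        rcases max_cases |x| |y| with ⟨h, -⟩ | ⟨h, -⟩
        · rw [hn', h] at hxn; exact absurd hxn (lt_irrefl _)
        · rw [hn', h]
      have hg2 : M0 < C₄ * (-x + N * (y ^ 2) ^ q) := by
        have e : n ^ 2 = y ^ 2 := by rw [hny, sq_abs]
        rw [e] at hbig2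
        have := mul_lt_mul_of_pos_left hxN hC₄0
        linarith
      have hkk := hk01 (2 * x + 2)
      rcases le_or_gt (k (2 * x + 2)) (1/2) with h | h
      · have p1 := mul_le_mul_of_nonneg_left hg2.le hkk.1
        have p2 := mul_lt_mul_of_pos_left hf2 (by linarith : 0 < 1 - k (2 * x + 2))
        linarith
      · have p1 := mul_lt_mul_of_pos_left hg2 (by linarith : 0 < k (2 * x + 2))
        have p2 := mul_le_mul_of_nonneg_left hf2.le (by linarith : 0 ≤ 1 - k (2 * x + 2))
        linarith
  · obtain ⟨c, hc, K, hK, hT⟩ := aux_T a₁ a₂ α₁ α₂ κ₁ κ₂ σ Dc hα₁ hα hσ hκ₂ hDc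
    obtain ⟨K4, hL4⟩ := aux_L4 a₁ a₂ α₁ α₂ κ₂ C₄ N q hα₁ hα₂ hκ₂ hC₄0 hN1 hq0 hq1
    obtain ⟨c3, hc3⟩ : ∃ c3, c3 = c * δ / 2 := ⟨_, rfl⟩
    have hc30 : 0 < c3 := by rw [hc3]; positivity
    obtain ⟨K3, hK3⟩ : ∃ K3, K3 = K * δ * C₃ := ⟨_, rfl⟩
    obtain ⟨W, hW⟩ := aux_large q (C₄ / b) hq0
    obtain ⟨ρ0, hρ0, hρ⟩ := hkρ (c3 / (16 * (κ₁ + 1))) (by positivity)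
    obtain ⟨W0, hW0⟩ : ∃ W0, W0 = max (max W 1) (|a₁| + α₁) := ⟨_, rfl⟩
    have hWW : W ≤ W0 := by rw [hW0]; exact (le_max_left _ _).trans (le_max_left _ _)
    have hW1 : 1 ≤ W0 := by rw [hW0]; exact (le_max_right _ _).trans (le_max_left _ _)
    have hWA : |a₁| + α₁ ≤ W0 := by rw [hW0]; exact le_max_right _ _
    obtain ⟨Km, hKm⟩ := aux_mid κ₁ c3 K3 (C₄ / 2) K4 (|a₁| + α₁) (C₄ + 2 * δ * Dc * C₃) (C₃ * (Dc + 1))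
      (C₄ * (1 + N)) C₄ b W0 (2 * B1) (4 * B2) ρ0 hκ₁ hc30 (by positivity) (by positivity) (by positivity)
      (by positivity) (by positivity) hW1 hWA (by positivity) (by positivity) hρ0
    obtain ⟨S, hS⟩ : ∃ S, S = c3 / 4 * (C₄ * (1 + N)) := ⟨_, rfl⟩
    refine ⟨c3 / 4, by positivity, |K3| + |Km| + |K4| + S ^ 2 / (4 * (C₄ / 2)) + 1, by positivity, ?_⟩
    have nS : 0 ≤ S ^ 2 / (4 * (C₄ / 2)) := by positivity
    rintro ⟨x, y⟩ hz
    obtain ⟨hy, -, hxN⟩ := hU x y hz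
    have hy2 := hw1 y hy
    have hy0 : y ≠ 0 := by rintro rfl; norm_num at hy2
    rw [aux_Lpsi a₁ a₂ α₁ α₂ κ₁ κ₂ k (deriv k) (deriv (deriv k)) C₃ C₄ Dc N q r δ (by linarith) D0 D1 x y hy0
      _ _ _ _ _ _ _ _ _ rfl rfl rfl rfl rfl rfl rfl rfl rfl]
    have hpsi : psi k C₃ C₄ Dc N q r δ (x, y) = k (2 * x + 2) * (C₄ * (-x + N * (y ^ 2) ^ q))
      + (1 - k (2 * x + 2)) * (C₃ * ((Dc * x ^ 2 + y ^ 2) ^ δ * (y ^ 2) ^ (-r))) := rfl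
    rw [hpsi]
    have hPy : y ^ 2 ≤ Dc * x ^ 2 + y ^ 2 := by
      have : 0 ≤ Dc * x ^ 2 := by positivity
      linarith
    have hP1 : 1 ≤ Dc * x ^ 2 + y ^ 2 := by linarith
    have hfl := aux_flow C₃ (Dc * x ^ 2 + y ^ 2) (y ^ 2) (y ^ 2) q r δ hC₃0.le hy2 le_rfl hPy hr0 hδ0 hqr
    have hfP := aux_fP C₃ (Dc * x ^ 2 + y ^ 2) (y ^ 2) r δ hC₃0.le hy2 hP1 hr0 (by linarith)
    have hfu : x ^ 2 ≤ 1 → C₃ * ((Dc * x ^ 2 + y ^ 2) ^ δ * (y ^ 2) ^ (-r)) ≤ C₃ * (Dc + 1) * (y ^ 2) ^ q := by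
      intro hx
      apply aux_fup C₃ _ _ _ _ _ _ hC₃0.le hy2 (by linarith) _ (by linarith) hδ0 (by linarith) hqr
      have : Dc * x ^ 2 ≤ Dc * y ^ 2 := mul_le_mul_of_nonneg_left (by linarith) (by linarith)
      linarith
    have hf0 : 0 ≤ C₃ * ((Dc * x ^ 2 + y ^ 2) ^ δ * (y ^ 2) ^ (-r)) := by positivity
    have hv1 : 1 ≤ (y ^ 2) ^ q := Real.one_le_rpow hy2 hq0.le
    have hv2 : ((y ^ 2) ^ q) ^ 2 ≤ y ^ 2 := by
      rw [← Real.rpow_natCast, ← Real.rpow_mul (by positivity)]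
      calc (y ^ 2) ^ (q * ((2:ℕ):ℝ)) ≤ (y ^ 2) ^ (1:ℝ) :=
            Real.rpow_le_rpow_of_exponent_le hy2 (by push_cast; linarith)
        _ = y ^ 2 := Real.rpow_one _
    have hWv : W0 ≤ y ^ 2 → C₄ ≤ b * (y ^ 2) ^ q := by
      intro h
      have := hW (y ^ 2) (by linarith)
      rw [div_lt_iff₀ hb0] at this
      linarith
    have hL4' := hL4 x y ((y ^ 2) ^ q)
    have hL3' : x ≤ -1/2 → _ := fun hx => aux_L3 a₁ a₂ α₁ α₂ κ₁ κ₂ σ δ Dc c K C₃ x y _ hD1 hκ₂ hκ₁ hδ0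
      (by linarith) hc hK hx hy2 hf0 hfP (hT x (y ^ 2) hx hy2)
    rw [← hr, ← hc3, ← hK3] at hL3'
    generalize (y ^ 2) ^ q = v at *
    generalize C₃ * ((Dc * x ^ 2 + y ^ 2) ^ δ * (y ^ 2) ^ (-r)) = f at *
    have b1 := le_abs_self K3
    have b2 := le_abs_self K4
    have b3 := le_abs_self Km
    have b1' := abs_nonneg K3
    have b2' := abs_nonneg K4
    have b3' := abs_nonneg Km
    rcases le_total x (-1) with hx | hx
    · obtain ⟨z1, z2⟩ := hkz (2 * x + 2) (Or.inl (by linarith))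
      rw [hk0 _ (by linarith), z1, z2]
      have h := hL3' (by linarith)
      have h2 : 0 ≤ c3 * f := by positivity
      generalize (a₁ * x - α₁ * x ^ 2 + y ^ 2) * (f * (2 * δ * Dc * x / (Dc * x ^ 2 + y ^ 2))) + _ + _ + _ = L3 at *
      linarith
    rcases le_total x (-1/2) with hx2 | hx2
    · have h3 := hL3' hx2
      have h4 := hL4' hx (by linarith) hy2 hv1 hv2
      have hax : |x| ≤ 1 := abs_le.2 ⟨hx, by linarith⟩
      have hx2' : x ^ 2 ≤ 1 := by rw [← sq_abs]; exact pow_le_one₀ (abs_nonneg _) hax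
      have ht : 2 * x + 2 ∈ Set.Icc (0:ℝ) 1 := ⟨by linarith, by linarith⟩
      have hNv : 0 ≤ N * v := by positivity
      refine (hKm v (y ^ 2) f (C₄ * (-x + N * v)) _ _ (a₁ * x - α₁ * x ^ 2 + y ^ 2)
        (-C₄ - f * (2 * δ * Dc * x / (Dc * x ^ 2 + y ^ 2))) (k (2 * x + 2)) (2 * deriv k (2 * x + 2))
        (4 * deriv (deriv k) (2 * x + 2)) hv1 hv2 hf0 (mul_nonneg hC₄0.le (by linarith)) (hfu hx2') ?_ h3 h4 ?_ ?_ ?_ hWv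
        (hk01 _).1 (hk01 _).2 (mul_nonneg (by norm_num) (hk1p _)) ?_ ?_ ?_).trans (by linarith)
      · rw [mul_assoc]
        apply mul_le_mul_of_nonneg_left _ hC₄0.le
        linarith
      · have e : a₁ * x - α₁ * x ^ 2 + y ^ 2 - y ^ 2 = a₁ * x - α₁ * x ^ 2 := by ring
        rw [e]
        calc |a₁ * x - α₁ * x ^ 2| ≤ |a₁ * x| + |α₁ * x ^ 2| := abs_sub _ _
          _ = |a₁| * |x| + α₁ * x ^ 2 := by rw [abs_mul, abs_of_nonneg (by positivity : 0 ≤ α₁ * x ^ 2)]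
          _ ≤ |a₁| * 1 + α₁ * 1 := by gcongr
          _ = _ := by ring
      · have e : (C₃ - C₄ * N) * v = b * v := by rw [hCC, hb]
        have : C₄ * (-x) ≤ C₄ * 1 := by
          apply mul_le_mul_of_nonneg_left _ hC₄0.le
          linarith
        linarith
      · have e : f * (2 * δ * Dc * x / (Dc * x ^ 2 + y ^ 2)) = 2 * δ * Dc * ((f / (Dc * x ^ 2 + y ^ 2)) * x) := by ring
        have h5 : f / (Dc * x ^ 2 + y ^ 2) ≤ C₃ := by rw [div_le_iff₀ (by linarith)]; exact hfP
        have h6 : 0 ≤ f / (Dc * x ^ 2 + y ^ 2) := by positivity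
        rw [e]
        calc |-C₄ - 2 * δ * Dc * ((f / (Dc * x ^ 2 + y ^ 2)) * x)| ≤ |-C₄| + |2 * δ * Dc * ((f / (Dc * x ^ 2 + y ^ 2)) * x)| := abs_sub _ _
          _ = C₄ + 2 * δ * Dc * ((f / (Dc * x ^ 2 + y ^ 2)) * |x|) := by
            rw [abs_neg, abs_of_pos hC₄0, abs_mul, abs_mul _ x, abs_of_nonneg h6, abs_of_nonneg (by positivity : 0 ≤ 2 * δ * Dc)]
          _ ≤ C₄ + 2 * δ * Dc * (C₃ * 1) := by gcongr
          _ = _ := by ring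
      · have := (le_abs_self _).trans (hB1 _ ht)
        linarith
      · rw [abs_mul, abs_of_pos (by norm_num : (0:ℝ) < 4)]
        linarith [hB2 _ ht]
      · rcases hρ _ ht with ⟨h1, h2⟩ | h
        · left
          refine ⟨h1, ?_⟩
          rw [abs_mul, abs_of_pos (by norm_num : (0:ℝ) < 4)]
          calc κ₁ * (4 * |deriv (deriv k) (2 * x + 2)|) ≤ (κ₁ + 1) * (4 * (c3 / (16 * (κ₁ + 1)))) := by
                gcongr; linarith
            _ = c3 / 4 := by field_simp; norm_num
        · right; exact h
    · obtain ⟨z1, z2⟩ := hkz (2 * x + 2) (Or.inr (by linarith))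
      rw [hk1 _ (by linarith), z1, z2]
      have h := hL4' hx (hxN hx2) hy2 hv1 hv2
      have hg : c3 / 4 * (C₄ * (-x + N * v)) ≤ S * v := by
        rw [hS, mul_assoc, mul_assoc]
        gcongr
        linarith
      have h7 := aux_sq S (C₄ / 2) v (by positivity)
      have h8 : C₄ / 2 * v ^ 2 ≤ C₄ / 2 * y ^ 2 := by gcongr
      generalize (a₁ * x - α₁ * x ^ 2 + y ^ 2) * (-C₄) + _ + _ = L4 at *
      linarith

/-- Patch 3. `φ_{3,4}` is a Lyapunov function on `U₃ ∪ U₄`. -/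
theorem statement9 (a₁ a₂ α₁ α₂ κ₁ κ₂ σ δ Dc N C₃ C₄ : ℝ)
    (hα₁ : 0 < α₁) (hα : α₁ < α₂)
    (hσ : σ = (α₁ + α₂) / (2 * α₂)) (hδ : δ = κ₂ / (8 * α₁))
    (hκ₂ : 0 < κ₂) (hκ₂' : κ₂ < 4 * α₁) (hκ₁ : 0 ≤ κ₁)
    (hDc : Dc = 1 + (α₂ + 2 * |a₂|) * (α₂ - α₁) / α₂) (hN : N = 1 + 4 * |a₂| / α₂)
    (hC₃ : C₃ = 1 / (2 * Dc ^ δ)) (hC₄ : C₄ = 1 / (3 * N * Dc ^ δ))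
    (k : ℝ → ℝ) (hk : ContDiff ℝ (⊤ : ℕ∞) k)
    (hk0 : ∀ t ≤ (0:ℝ), k t = 0) (hk1 : ∀ t ≥ (1:ℝ), k t = 1)
    (hk' : ∀ t ∈ Set.Ioo (0:ℝ) 1, 0 < deriv k t) :
    IsLyapunovOn a₁ a₂ α₁ α₂ κ₁ κ₂ (phi34 k C₃ C₄ Dc N σ δ) (U3 ∪ U4 N) := by
  have hα₂ : 0 < α₂ := hα₁.trans hα
  have hδ0 : 0 < δ := by rw [hδ]; positivity
  have hδ1 : δ < 1 / 2 := by rw [hδ, div_lt_iff₀ (by positivity)]; linarith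
  have hN1 : 1 ≤ N := by
    rw [hN]
    have : 0 ≤ 4 * |a₂| / α₂ := by positivity
    linarith
  have hD0 : 0 < Dc := by
    rw [hDc]
    have : 0 < α₂ - α₁ := by linarith
    positivity
  rw [aux_phi34 k C₃ C₄ Dc N σ δ hD0.le hk0 hk1]
  exact aux_lyap a₁ a₂ α₁ α₂ κ₁ κ₂ σ δ Dc N C₃ C₄ (Dc ^ δ) hα₁ hα hσ hδ0 hδ1 hκ₂ hκ₁ hDc hN1
    (by positivity) hC₃ hC₄ k hk hk0 hk1 hk'
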